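/- Let G be a finite abelian group with exp(G) = n, rank r, and such that n is not a prime power. Let G₀ ⊆ G be a minimal non-half-factorial LCN-set with |G₀| ≥ r + 2, with h ∈ ⟨G₀ \ {h}⟩ for all h ∈ G₀, and suppose there is a subset G₂ ⊆ G₀ with ⟨G₂⟩ = ⟨G₀⟩ and |G₂| ≤ |G₀| − 2. Then min Δ(G₀) ≤ (n + r − 3)/2. -/

import Mathlib

/-- A sequence over `G₀` (a multiset with entries in `G₀`) with sum zero. -/
def IsZeroSumSeq {G : Type*} [AddCommGroup G] (G₀ : Set G) (S : Multiset G) : Prop :=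
  (∀ g ∈ S, g ∈ G₀) ∧ S.sum = 0

/-- A minimal zero-sum sequence (atom) over `G₀`. -/
def IsAtomSeq {G : Type*} [AddCommGroup G] (G₀ : Set G) (A : Multiset G) : Prop :=
  IsZeroSumSeq G₀ A ∧ A ≠ 0 ∧ ∀ B ≤ A, B ≠ 0 → B.sum = 0 → B = A

/-- The set of lengths of factorizations of `B` into atoms over `G₀`. -/
def LengthSet {G : Type*} [AddCommGroup G] (G₀ : Set G) (B : Multiset G) : Set ℕ :=
  {k | ∃ F : Multiset (Multiset G), F.card = k ∧ (∀ A ∈ F, IsAtomSeq G₀ A) ∧ F.sum = B}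

/-- The set of successive distances of a set of naturals. -/
def DistSet (L : Set ℕ) : Set ℕ :=
  {d | ∃ a b, a ∈ L ∧ b ∈ L ∧ a < b ∧ b - a = d ∧ ∀ c ∈ L, ¬(a < c ∧ c < b)}

/-- The set of distances `Δ(G₀)`. -/
def DeltaSet {G : Type*} [AddCommGroup G] (G₀ : Set G) : Set ℕ :=
  {d | ∃ B : Multiset G, IsZeroSumSeq G₀ B ∧ d ∈ DistSet (LengthSet G₀ B)}

/-- The cross number of a sequence. -/
noncomputable def crossNum {G : Type*} [AddCommGroup G] (S : Multiset G) : ℚ :=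
  (S.map (fun g => (1 : ℚ) / addOrderOf g)).sum

/-- `G₀` is an LCN-set: every atom has cross number at least 1. -/
def IsLCNSet {G : Type*} [AddCommGroup G] (G₀ : Set G) : Prop :=
  ∀ A : Multiset G, IsAtomSeq G₀ A → 1 ≤ crossNum A

/-- The set of minimal distances `Δ*(G)`. -/
def DeltaStar (G : Type*) [AddCommGroup G] : Set ℕ :=
  {d | ∃ G₀ : Set G, DeltaSet G₀ ≠ ∅ ∧ d = sInf (DeltaSet G₀)}

/-- `m(G)`: the maximum of `min Δ(G₀)` over non-half-factorial LCN-sets `G₀`. -/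
noncomputable def mConst (G : Type*) [AddCommGroup G] : ℕ :=
  sSup {d | ∃ G₀ : Set G, IsLCNSet G₀ ∧ DeltaSet G₀ ≠ ∅ ∧ d = sInf (DeltaSet G₀)}

/-- The rank of a finite abelian group: the maximal `k` such that `(ZMod p)^k`
embeds into `G` for some prime `p`. -/
noncomputable def grank (G : Type*) [AddCommGroup G] : ℕ :=
  sSup {k | ∃ p : ℕ, p.Prime ∧ ∃ f : (Fin k → ZMod p) →+ G, Function.Injective f}

/-- The system of sets of lengths `L(G)`. -/
def SystemSets (G : Type*) [AddCommGroup G] : Set (Set ℕ) :=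
  {L | ∃ B : Multiset G, B.sum = 0 ∧ L = LengthSet Set.univ B}

/-- The Davenport constant: the maximal length of a minimal zero-sum sequence. -/
noncomputable def DavenportC (G : Type*) [AddCommGroup G] : ℕ :=
  sSup {k | ∃ A : Multiset G, IsAtomSeq (Set.univ : Set G) A ∧ A.card = k}


/-! ### Ranks of finite abelian groups -/

theorem le_grank {G : Type*} [AddCommGroup G] [Finite G] {p k : ℕ} (hp : p.Prime)
    (f : (Fin k → ZMod p) →+ G) (hf : Function.Injective f) : k ≤ grank G := by
  refine le_csSup ⟨Nat.card G, ?_⟩ ⟨p, hp, f, hf⟩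
  rintro j ⟨q, hq, g, hg⟩
  have h := Nat.card_le_card_of_injective g hg
  simp only [Nat.card_fun, Nat.card_zmod, Nat.card_fin] at h
  exact (Nat.lt_pow_self hq.one_lt).le.trans h

theorem exists_addEquiv_pi_zmod {V : Type*} [AddCommGroup V] [Finite V] (p : ℕ) [Fact p.Prime]
    [Module (ZMod p) V] : Nonempty ((Fin (Module.finrank (ZMod p) V) → ZMod p) ≃+ V) :=
  ⟨(Module.finBasis (ZMod p) V).equivFun.symm.toAddEquiv⟩

theorem exists_fun_fin_closure_eq_top {V : Type*} [AddCommGroup V] [Finite V] (p : ℕ)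
    [Fact p.Prime] [Module (ZMod p) V] {t : Set V} (ht : AddSubgroup.closure t = ⊤) :
    ∃ k ≤ Module.finrank (ZMod p) V, ∃ f : Fin k → V, (∀ i, f i ∈ t) ∧
      AddSubgroup.closure (Set.range f) = ⊤ := by
  obtain ⟨f, hft, hspan, -⟩ := Submodule.exists_fun_fin_finrank_span_eq (ZMod p) t
  refine ⟨_, Submodule.finrank_le _, f, hft, eq_top_iff.2 ?_⟩
  have hle : Submodule.span (ZMod p) (Set.range f) ≤
      AddSubgroup.toZModSubmodule p (AddSubgroup.closure (Set.range f)) :=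
    Submodule.span_le.2 AddSubgroup.subset_closure
  rw [← ht, AddSubgroup.closure_le]
  exact fun x hx => hle (hspan.ge (Submodule.subset_span hx))

/-- Each prime `p` admits at most `grank G` elements of a generating set of a subgroup `M` that
generate a subgroup of `M` of index prime to `p`. -/
theorem exists_subset_ncard_le_grank {G M : Type*} [AddCommGroup G] [Finite G] [AddCommGroup M]
    (ι : M →+ G) (hι : Function.Injective ι) {s : Set M} (hs : AddSubgroup.closure s = ⊤)
    {p : ℕ} (hp : p.Prime) :
    ∃ E ⊆ s, E.ncard ≤ grank G ∧ ¬ p ∣ (AddSubgroup.closure E).index := by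
  have : Fact p.Prime := ⟨hp⟩
  have : Finite M := Finite.of_injective ι hι
  let π : M →+ M := nsmulAddMonoidHom p
  let mK : Module (ZMod p) π.ker := AddCommGroup.zmodModule fun x => Subtype.ext x.2
  let mQ : Module (ZMod p) (M ⧸ π.range) := QuotientAddGroup.zmodModule fun x => ⟨x, rfl⟩
  have hcard : Nat.card π.ker = Nat.card (M ⧸ π.range) := by
    have h1 := π.ker.card_mul_index
    rw [AddSubgroup.index_ker, ← π.range.card_mul_index, mul_comm] at h1
    exact Nat.eq_of_mul_eq_mul_left Nat.card_pos h1
  have hrank : Module.finrank (ZMod p) (M ⧸ π.range) ≤ grank G := by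
    obtain ⟨e⟩ := exists_addEquiv_pi_zmod (V := π.ker) p
    obtain ⟨e'⟩ := exists_addEquiv_pi_zmod (V := M ⧸ π.range) p
    rw [← Nat.card_congr e.toEquiv, ← Nat.card_congr e'.toEquiv, Nat.card_fun, Nat.card_fun,
      Nat.card_zmod, Nat.card_fin, Nat.card_fin] at hcard
    rw [← Nat.pow_right_injective hp.two_le hcard]
    exact le_grank hp ((ι.comp π.ker.subtype).comp e.toAddMonoidHom)
      (hι.comp (Subtype.val_injective.comp e.injective))
  let q := QuotientAddGroup.mk' π.range
  obtain ⟨k, hk, f, hfs, hf⟩ := exists_fun_fin_closure_eq_top p (t := q '' s) <| by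
    rw [← AddMonoidHom.map_closure, hs, ← AddMonoidHom.range_eq_map]
    exact AddMonoidHom.range_eq_top.2 (QuotientAddGroup.mk'_surjective _)
  choose e he hef using hfs
  refine ⟨Set.range e, by rintro _ ⟨i, rfl⟩; exact he i, ?_, ?_⟩
  · rw [← Set.image_univ]
    refine (Set.ncard_image_le Set.finite_univ).trans ?_
    rw [Set.ncard_univ, Nat.card_fin]
    exact hk.trans hrank
  have hqe : (AddSubgroup.closure (Set.range e)).map q = ⊤ := by
    rw [AddMonoidHom.map_closure, ← Set.range_comp, ← hf]
    exact congrArg _ (congrArg Set.range (funext hef))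
  set H := AddSubgroup.closure (Set.range e)
  have hdecomp (x : M) : ∃ y, p • y - x ∈ H := by
    have hx : q x ∈ H.map q := hqe ▸ AddSubgroup.mem_top _
    obtain ⟨a, ha, hax⟩ := hx
    obtain ⟨y, hy⟩ := (QuotientAddGroup.eq.1 hax : -a + x ∈ π.range)
    exact ⟨y, by
      have : p • y = -a + x := hy
      rw [this, add_sub_cancel_right]; exact neg_mem ha⟩
  intro hdvd
  have hinj : Function.Injective fun x : M ⧸ H => p • x := by
    rw [Finite.injective_iff_surjective]
    intro x
    obtain ⟨x, rfl⟩ := QuotientAddGroup.mk'_surjective _ x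
    obtain ⟨y, hy⟩ := hdecomp x
    refine ⟨QuotientAddGroup.mk' H y, ?_⟩
    dsimp only
    rw [← map_nsmul, ← sub_eq_zero, ← map_sub]
    exact (QuotientAddGroup.eq_zero_iff _).2 hy
  obtain ⟨x, hx⟩ := exists_prime_addOrderOf_dvd_card' p hdvd
  have h0 : x = 0 := hinj (by simpa [hx] using addOrderOf_nsmul_eq_zero x)
  rw [h0, addOrderOf_zero] at hx
  exact hp.one_lt.ne hx

theorem exists_subset_nsmul_mem_closure {G : Type*} [AddCommGroup G] [Finite G] {T : Set G}
    {h : G} (hh : h ∈ AddSubgroup.closure T) {p : ℕ} (hp : p.Prime) :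
    ∃ E ⊆ T, E.ncard ≤ grank G ∧ ∃ m : ℕ, ¬ p ∣ m ∧ m • h ∈ AddSubgroup.closure E := by
  obtain ⟨E, hE, hcard, hndvd⟩ := exists_subset_ncard_le_grank (AddSubgroup.closure T).subtype
    Subtype.val_injective AddSubgroup.closure_closure_coe_preimage hp
  refine ⟨(AddSubgroup.closure T).subtype '' E, by rintro _ ⟨x, hx, rfl⟩; exact hE hx,
    (Set.ncard_image_le E.toFinite).trans hcard, _, hndvd, ?_⟩
  rw [← AddMonoidHom.map_closure]
  exact ⟨_, (AddSubgroup.closure E).nsmul_index_mem ⟨h, hh⟩, rfl⟩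

/-! ### Zero-sum sequences and their factorizations -/

section ZeroSum

variable {G : Type*} [AddCommGroup G] {G₀ G₁ : Set G} {A B S U Z : Multiset G}

theorem IsAtomSeq.mono (hA : IsAtomSeq G₁ A) (h : ∀ g ∈ A, g ∈ G₀) : IsAtomSeq G₀ A :=
  ⟨⟨h, hA.1.2⟩, hA.2⟩

theorem IsZeroSumSeq.exists_factorization (hS : IsZeroSumSeq G₀ S) :
    ∃ F : Multiset (Multiset G), (∀ A ∈ F, IsAtomSeq G₀ A) ∧ F.sum = S := by
  induction S using Multiset.strongInductionOn with
  | ih S ih =>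
    rcases eq_or_ne S 0 with rfl | h0
    · exact ⟨0, by simp, rfl⟩
    by_cases hA : IsAtomSeq G₀ S
    · exact ⟨{S}, by simpa using hA, by simp⟩
    · obtain ⟨B, hBS, hB0, hB, hne⟩ : ∃ B ≤ S, B ≠ 0 ∧ B.sum = 0 ∧ B ≠ S := by
        by_contra! hc
        exact hA ⟨hS, h0, hc⟩
      obtain ⟨C, rfl⟩ := Multiset.le_iff_exists_add.1 hBS
      have hC0 : C ≠ 0 := by rintro rfl; simp at hne
      have hC : C.sum = 0 := by simpa [hB] using hS.2
      obtain ⟨F, hF, hFs⟩ := ih B (lt_of_le_of_ne hBS hne)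
        ⟨fun g hg => hS.1 g (Multiset.mem_add.2 (.inl hg)), hB⟩
      obtain ⟨F', hF', hFs'⟩ := ih C (lt_of_le_of_ne (Multiset.le_add_left _ _) (by simpa using hB0))
        ⟨fun g hg => hS.1 g (Multiset.mem_add.2 (.inr hg)), hC⟩
      refine ⟨F + F', fun A hA => ?_, by rw [Multiset.sum_add, hFs, hFs']⟩
      exact (Multiset.mem_add.1 hA).elim (hF A) (hF' A)

theorem isAtomSeq_replicate [Finite G] {g : G} (hg : g ∈ G₀) :
    IsAtomSeq G₀ (Multiset.replicate (addOrderOf g) g) := by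
  refine ⟨⟨fun x hx => Multiset.eq_of_mem_replicate hx ▸ hg, by simp⟩, ?_, fun B hB hB0 hBs => ?_⟩
  · rw [ne_eq, ← Multiset.card_eq_zero, Multiset.card_replicate]
    exact (addOrderOf_pos g).ne'
  · obtain ⟨k, hk, rfl⟩ := Multiset.le_replicate_iff.1 hB
    rw [Multiset.sum_replicate] at hBs
    have hk0 : k ≠ 0 := by rintro rfl; simp at hB0
    rw [le_antisymm hk (Nat.le_of_dvd (Nat.pos_of_ne_zero hk0) (addOrderOf_dvd_of_nsmul_eq_zero hBs))]

theorem crossNum_add (S T : Multiset G) : crossNum (S + T) = crossNum S + crossNum T := by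
  simp [crossNum]

theorem crossNum_sum (F : Multiset (Multiset G)) : crossNum F.sum = (F.map crossNum).sum := by
  induction F using Multiset.induction with
  | empty => simp [crossNum]
  | cons A F ih => simp [crossNum_add, ih]

theorem crossNum_replicate_addOrderOf [Finite G] (g : G) :
    crossNum (Multiset.replicate (addOrderOf g) g) = 1 := by
  simp [crossNum, (addOrderOf_pos g).ne']

theorem crossNum_sum_of_forall_eq_one {F : Multiset (Multiset G)}
    (hF : ∀ A ∈ F, crossNum A = 1) : crossNum F.sum = F.card := by
  rw [crossNum_sum, Multiset.map_congr rfl hF]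
  simp

theorem card_le_exponent_mul_crossNum [Finite G] (S : Multiset G) :
    (S.card : ℚ) ≤ AddMonoid.exponent G * crossNum S := by
  induction S using Multiset.induction with
  | empty => simp [crossNum]
  | cons g S ih =>
    have hg : (0 : ℚ) < addOrderOf g := by exact_mod_cast addOrderOf_pos g
    have hle : (addOrderOf g : ℚ) ≤ AddMonoid.exponent G := by
      exact_mod_cast Nat.le_of_dvd (AddMonoid.ExponentExists.of_finite.exponent_pos)
        (AddMonoid.addOrder_dvd_exponent g)
    have h1 : (1 : ℚ) ≤ AddMonoid.exponent G * (1 / addOrderOf g) := by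
      rw [mul_one_div, le_div_iff₀ hg, one_mul]; exact hle
    rw [← Multiset.singleton_add, crossNum_add]
    have : crossNum {g} = 1 / addOrderOf g := by simp [crossNum]
    rw [this, mul_add, Multiset.card_add]
    push_cast [Multiset.card_singleton]
    linarith

/-- Two factorization lengths of the same sequence bound the minimal distance. -/
theorem sInf_deltaSet_le_sub (hB : IsZeroSumSeq G₀ B) {a b : ℕ} (ha : a ∈ LengthSet G₀ B)
    (hb : b ∈ LengthSet G₀ B) (hab : a < b) :
    (DeltaSet G₀).Nonempty ∧ sInf (DeltaSet G₀) ≤ b - a := by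
  classical
  have hex : ∃ c, c ∈ LengthSet G₀ B ∧ a < c := ⟨b, hb, hab⟩
  have hmem : Nat.find hex - a ∈ DeltaSet G₀ :=
    ⟨B, hB, a, Nat.find hex, ha, (Nat.find_spec hex).1, (Nat.find_spec hex).2, rfl,
      fun c hc h => Nat.find_min hex h.2 ⟨hc, h.1⟩⟩
  exact ⟨⟨_, hmem⟩, (Nat.sInf_le hmem).trans (Nat.sub_le_sub_right (Nat.find_min' hex ⟨hb, hab⟩) a)⟩

/-- Atoms over a half-factorial set have cross number one. -/
theorem IsAtomSeq.crossNum_eq_one [Finite G] (hΔ : DeltaSet G₁ = ∅) (hA : IsAtomSeq G₁ A) :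
    crossNum A = 1 := by
  classical
  set N := AddMonoid.exponent G
  have hNpos : 0 < N := AddMonoid.ExponentExists.of_finite.exponent_pos
  let F : Multiset (Multiset G) := ∑ g ∈ A.toFinset,
    Multiset.replicate (N / addOrderOf g * A.count g) (Multiset.replicate (addOrderOf g) g)
  have hF : ∀ W ∈ F, IsAtomSeq G₁ W ∧ crossNum W = 1 := by
    intro W hW
    obtain ⟨g, hg, hWg⟩ := Multiset.mem_sum.1 hW
    rw [Multiset.eq_of_mem_replicate hWg]
    exact ⟨isAtomSeq_replicate (hA.1.1 g (Multiset.mem_toFinset.1 hg)),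
      crossNum_replicate_addOrderOf g⟩
  have hsum : F.sum = N • A := by
    have hrep (g : G) : (Multiset.replicate (N / addOrderOf g * A.count g)
        (Multiset.replicate (addOrderOf g) g)).sum = N • A.count g • {g} := by
      rw [Multiset.sum_replicate, ← Multiset.nsmul_singleton, ← mul_nsmul', ← mul_nsmul',
        mul_right_comm, Nat.div_mul_cancel (AddMonoid.addOrder_dvd_exponent g)]
    simp only [F, Multiset.sum_sum, hrep]
    rw [← Finset.smul_sum, Multiset.toFinset_sum_count_nsmul_eq]
  have hlen : (F.card : ℚ) = N * crossNum A := by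
    rw [← crossNum_sum_of_forall_eq_one fun W hW => (hF W hW).2, hsum,
      ← Multiset.sum_replicate, crossNum_sum]
    simp
  have hzs : IsZeroSumSeq G₁ (N • A) :=
    ⟨fun g hg => hA.1.1 g (Multiset.mem_of_mem_nsmul hg), by
      rw [← Multiset.sum_replicate]; simp [Multiset.sum_nsmul, hA.1.2]⟩
  have h1 : F.card ∈ LengthSet G₁ (N • A) := ⟨F, rfl, fun W hW => (hF W hW).1, hsum⟩
  have h2 : N ∈ LengthSet G₁ (N • A) := ⟨Multiset.replicate N A, by simp,
    fun W hW => Multiset.eq_of_mem_replicate hW ▸ hA, Multiset.sum_replicate _ _⟩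
  have heq : F.card = N := by
    rcases lt_trichotomy F.card N with h | h | h
    · exact absurd (sInf_deltaSet_le_sub hzs h1 h2 h).1 (by simp [hΔ])
    · exact h
    · exact absurd (sInf_deltaSet_le_sub hzs h2 h1 h).1 (by simp [hΔ])
  rw [heq] at hlen
  have : (N : ℚ) ≠ 0 := by exact_mod_cast hNpos.ne'
  exact mul_left_cancel₀ this (by rw [← hlen, mul_one])

/-- `S` is a product of atoms over `G₀` of cross number one. -/
def HasUnitFactorization (G₀ : Set G) (S : Multiset G) : Prop :=
  ∃ F : Multiset (Multiset G), (∀ W ∈ F, IsAtomSeq G₀ W ∧ crossNum W = 1) ∧ F.sum = S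

theorem HasUnitFactorization.add (hA : HasUnitFactorization G₀ A)
    (hB : HasUnitFactorization G₀ B) : HasUnitFactorization G₀ (A + B) := by
  obtain ⟨F, hF, rfl⟩ := hA
  obtain ⟨F', hF', rfl⟩ := hB
  exact ⟨F + F', fun W hW => (Multiset.mem_add.1 hW).elim (hF W) (hF' W), Multiset.sum_add _ _⟩

theorem hasUnitFactorization_nsmul (hA : HasUnitFactorization G₀ A) (k : ℕ) :
    HasUnitFactorization G₀ (k • A) := by
  induction k with
  | zero => exact ⟨0, by simp, by simp⟩
  | succ k ih => rw [succ_nsmul]; exact ih.add hA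

theorem deltaSet_eq_empty_of_crossNum_eq_one
    (h : ∀ A, IsAtomSeq G₀ A → crossNum A = 1) : DeltaSet G₀ = ∅ := by
  refine Set.eq_empty_of_forall_notMem ?_
  rintro _ ⟨B, -, a, b, ⟨F, rfl, hF, rfl⟩, ⟨F', rfl, hF', hFF'⟩, hab, -⟩
  have h1 := crossNum_sum_of_forall_eq_one fun A hA => h A (hF A hA)
  rw [← hFF', crossNum_sum_of_forall_eq_one fun A hA => h A (hF' A hA)] at h1
  exact hab.ne' (by exact_mod_cast h1)

/-- If `W₁ ⋯ Wₛ = Z U`, no `Wᵢ` divides `Z`, and every term of `U` occurs in `Z`, then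
`2 s ≤ |U| + |supp U|`. -/
theorem two_mul_card_le {α : Type*} [DecidableEq α] {U Z : Multiset α} {F : Multiset (Multiset α)}
    (hF : F.sum = Z + U) (hnle : ∀ W ∈ F, ¬ W ≤ Z) (hZ : ∀ g ∈ U, g ∈ Z) :
    2 * F.card ≤ U.card + U.toFinset.card := by
  let c (g : α) : ℕ := (F.filter fun W => Z.count g < W.count g).card
  have hbound (g : α) (hg : g ∈ U) : 2 * c g ≤ U.count g + 1 := by
    have h1 : c g * (Z.count g + 1) ≤ Z.count g + U.count g := by
      rw [← Multiset.count_add, ← hF, ← Multiset.coe_countAddMonoidHom, map_multiset_sum]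
      calc c g * (Z.count g + 1)
          ≤ ((F.filter fun W => Z.count g < W.count g).map (Multiset.count g)).sum := by
            have := Multiset.card_nsmul_le_sum
              (s := (F.filter fun W => Z.count g < W.count g).map (Multiset.count g))
              (a := Z.count g + 1) (by
                intro x hx
                obtain ⟨W, hW, rfl⟩ := Multiset.mem_map.1 hx
                exact (Multiset.mem_filter.1 hW).2)
            simpa using this
        _ ≤ (F.map (Multiset.count g)).sum := by
            conv_rhs => rw [← Multiset.filter_add_not (fun W => Z.count g < W.count g) F]
            rw [Multiset.map_add, Multiset.sum_add]
            exact Nat.le_add_right _ _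
    have hz : 1 ≤ Z.count g := Multiset.one_le_count_iff_mem.2 (hZ g hg)
    have hu : 1 ≤ U.count g := Multiset.one_le_count_iff_mem.2 hg
    rcases Nat.eq_zero_or_pos (c g) with h0 | hpos
    · omega
    · obtain ⟨k, hk⟩ := Nat.exists_eq_succ_of_ne_zero hpos.ne'
      rw [hk] at h1 ⊢
      nlinarith [Nat.mul_le_mul_left k hz]
  have hcover : F.card ≤ ∑ g ∈ U.toFinset, c g := by
    have hmem : ∀ W ∈ F, ∃ g ∈ U.toFinset, Z.count g < W.count g := by
      intro W hW
      obtain ⟨g, hg⟩ : ∃ g, Z.count g < W.count g := by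
        by_contra! hc
        exact hnle W hW (Multiset.le_iff_count.2 hc)
      refine ⟨g, ?_, hg⟩
      have h := Multiset.count_le_of_le g (Multiset.le_sum_of_mem hW)
      rw [hF, Multiset.count_add] at h
      rw [Multiset.mem_toFinset, ← Multiset.one_le_count_iff_mem]
      omega
    clear hF hnle
    simp only [c]
    clear c hbound
    induction F using Multiset.induction with
    | empty => simp
    | cons W F ih =>
      obtain ⟨g, hg, hlt⟩ := hmem W (Multiset.mem_cons_self _ _)
      have ih := ih fun V hV => hmem V (Multiset.mem_cons_of_mem hV)
      simp only [Multiset.filter_cons, Multiset.card_add, Finset.sum_add_distrib,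
        Multiset.card_cons]
      have : 1 ≤ ∑ g ∈ U.toFinset,
          (if Z.count g < W.count g then ({W} : Multiset (Multiset α)) else 0).card :=
        le_trans (by simp [hlt]) (Finset.single_le_sum (fun _ _ => Nat.zero_le _) hg)
      omega
  calc 2 * F.card ≤ ∑ g ∈ U.toFinset, 2 * c g := by rw [← Finset.mul_sum]; omega
    _ ≤ ∑ g ∈ U.toFinset, (U.count g + 1) :=
        Finset.sum_le_sum fun g hg => hbound g (Multiset.mem_toFinset.1 hg)
    _ = U.card + U.toFinset.card := by
        rw [Finset.sum_add_distrib, Multiset.toFinset_sum_count_eq, Finset.card_eq_sum_ones]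

theorem exists_not_hasUnitFactorization_two_mul_card_le [DecidableEq G]
    (hfull : ∀ Z, IsZeroSumSeq G₀ Z → ¬ HasUnitFactorization G₀ Z → ∀ g ∈ G₀, g ∈ Z)
    (hU : ∀ g ∈ U, g ∈ G₀) (hZ : IsZeroSumSeq G₀ Z) (hZu : ¬ HasUnitFactorization G₀ Z)
    (hZU : HasUnitFactorization G₀ (Z + U)) :
    ∃ (Z' : Multiset G) (F : Multiset (Multiset G)), IsZeroSumSeq G₀ Z' ∧
      ¬ HasUnitFactorization G₀ Z' ∧
      (∀ W ∈ F, IsAtomSeq G₀ W ∧ crossNum W = 1) ∧ F.sum = Z' + U ∧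
      2 * F.card ≤ U.card + U.toFinset.card := by
  induction Z using Multiset.strongInductionOn with
  | ih Z ih =>
    obtain ⟨F, hF, hFs⟩ := hZU
    by_cases hle : ∃ W ∈ F, W ≤ Z
    · obtain ⟨W, hW, hWZ⟩ := hle
      obtain ⟨Y, rfl⟩ := Multiset.le_iff_exists_add.1 hWZ
      obtain ⟨F', rfl⟩ := Multiset.exists_cons_of_mem hW
      obtain ⟨hWa, hW1⟩ := hF W hW
      refine ih Y (lt_of_le_of_ne (Multiset.le_add_left _ _) (by simpa using hWa.2.1))
        ⟨fun g hg => hZ.1 g (Multiset.mem_add.2 (.inr hg)), by simpa [hWa.1.2] using hZ.2⟩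
        (fun hY => hZu (.add ⟨{W}, by simp [hWa, hW1], by simp⟩ hY))
        ⟨F', fun V hV => hF V (Multiset.mem_cons_of_mem hV), ?_⟩
      rw [Multiset.sum_cons, add_assoc] at hFs
      exact add_left_cancel hFs
    · push Not at hle
      exact ⟨Z, F, hZ, hZu, hF, hFs,
        two_mul_card_le hFs hle fun g hg => hfull Z hZ hZu g (hU g hg)⟩

theorem two_mul_sInf_deltaSet_add_four_le [DecidableEq G] (hlcn : IsLCNSet G₀)
    (hfull : ∀ Z, IsZeroSumSeq G₀ Z → ¬ HasUnitFactorization G₀ Z → ∀ g ∈ G₀, g ∈ Z)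
    (hU : IsAtomSeq G₀ U) (hU1 : crossNum U = 1)
    (hZ : IsZeroSumSeq G₀ Z) (hZu : ¬ HasUnitFactorization G₀ Z)
    (hZU : HasUnitFactorization G₀ (Z + U)) :
    2 * sInf (DeltaSet G₀) + 4 ≤ U.card + U.toFinset.card := by
  obtain ⟨Y, F, hY, hYu, hF, hFs, hcard⟩ :=
    exists_not_hasUnitFactorization_two_mul_card_le hfull hU.1.1 hZ hZu hZU
  obtain ⟨E, hE, rfl⟩ := hY.exists_factorization
  have hlt : E.card + 1 < F.card := by
    have h1 : crossNum F.sum = F.card := crossNum_sum_of_forall_eq_one fun W hW => (hF W hW).2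
    have h2 : (E.card : ℚ) < (E.map crossNum).sum := by
      obtain ⟨A, hA, hA1⟩ : ∃ A ∈ E, crossNum A ≠ 1 := by
        by_contra! hc
        exact hYu ⟨E, fun W hW => ⟨hE W hW, hc W hW⟩, rfl⟩
      have := Multiset.sum_lt_sum (s := E) (f := fun _ => (1 : ℚ)) (g := crossNum)
        (fun W hW => hlcn W (hE W hW)) ⟨A, hA, lt_of_le_of_ne (hlcn A (hE A hA)) hA1.symm⟩
      simpa using this
    rw [hFs, crossNum_add, crossNum_sum, hU1] at h1
    have h3 : ((E.card + 1 : ℕ) : ℚ) < F.card := by push_cast; linarith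
    exact_mod_cast h3
  have hE0 : 1 ≤ E.card := by
    rw [Nat.one_le_iff_ne_zero, ne_eq, Multiset.card_eq_zero]
    rintro rfl
    exact hYu ⟨0, by simp, rfl⟩
  have hzs : IsZeroSumSeq G₀ (E.sum + U) :=
    ⟨fun g hg => (Multiset.mem_add.1 hg).elim (hY.1 g) (hU.1.1 g), by
      rw [Multiset.sum_add, hY.2, hU.1.2, add_zero]⟩
  have := (sInf_deltaSet_le_sub hzs (a := E.card + 1) (b := F.card)
    ⟨U ::ₘ E, by simp, by simpa using ⟨hU, hE⟩, by rw [Multiset.sum_cons, add_comm]⟩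
    ⟨F, rfl, fun W hW => (hF W hW).1, hFs⟩ hlt).2
  omega

theorem exists_hasUnitFactorization_add {𝒰 : Set (Multiset G)}
    (h𝒰 : ∀ U ∈ 𝒰, IsZeroSumSeq G₀ U) {F : Multiset (Multiset G)} (hF : ∀ U ∈ F, U ∈ 𝒰)
    (hA : IsZeroSumSeq G₀ A) (hAu : ¬ HasUnitFactorization G₀ A)
    (hAF : HasUnitFactorization G₀ (A + F.sum)) :
    ∃ U ∈ 𝒰, ∃ Z, IsZeroSumSeq G₀ Z ∧ ¬ HasUnitFactorization G₀ Z ∧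
      HasUnitFactorization G₀ (Z + U) := by
  induction F using Multiset.induction generalizing A with
  | empty => exact absurd (by simpa using hAF) hAu
  | cons U F ih =>
    have hU := hF U (Multiset.mem_cons_self _ _)
    by_cases h : HasUnitFactorization G₀ (A + U)
    · exact ⟨U, hU, A, hA, hAu, h⟩
    · refine ih (fun V hV => hF V (Multiset.mem_cons_of_mem hV)) (A := A + U) ⟨fun g hg => ?_, ?_⟩ h
        (by rwa [Multiset.sum_cons, ← add_assoc] at hAF)
      · exact (Multiset.mem_add.1 hg).elim (hA.1 g) ((h𝒰 U hU).1 g)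
      · rw [Multiset.sum_add, hA.2, (h𝒰 U hU).2, add_zero]

theorem exists_atom_not_dvd_count [Finite G] [DecidableEq G] {h : G} (hh : h ∈ G₀)
    (hgen : h ∈ AddSubgroup.closure (G₀ \ {h})) {p : ℕ} (hp : p.Prime) :
    ∃ U, IsAtomSeq G₀ U ∧ U.toFinset.card ≤ grank G + 1 ∧ ¬ p ∣ U.count h := by
  obtain ⟨E, hE, hcard, m, hpm, hm⟩ := exists_subset_nsmul_mem_closure hgen hp
  have hneg : -(m • h) ∈ AddSubmonoid.closure E := by
    rw [← AddSubgroup.closure_toAddSubmonoid_of_finite]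
    exact (AddSubgroup.closure E).neg_mem hm
  obtain ⟨S, hS, hSs⟩ := AddSubmonoid.exists_multiset_of_mem_closure hneg
  have hzs : IsZeroSumSeq (insert h E) (Multiset.replicate m h + S) := by
    refine ⟨fun g hg => ?_, by simp [hSs]⟩
    rcases Multiset.mem_add.1 hg with hg | hg
    · exact .inl (Multiset.eq_of_mem_replicate hg)
    · exact .inr (hS g hg)
  obtain ⟨F, hF, hFs⟩ := hzs.exists_factorization
  have hcount : (F.map (Multiset.count h)).sum = m := by
    have : S.count h = 0 := Multiset.count_eq_zero.2 fun hhS => (hE (hS h hhS)).2 rfl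
    have h2 := congrArg (Multiset.countAddMonoidHom h) hFs
    rw [map_multiset_sum] at h2
    simpa [this] using h2
  obtain ⟨U, hUF, hU⟩ : ∃ U ∈ F, ¬ p ∣ U.count h := by
    by_contra! hc
    refine hpm (hcount ▸ Multiset.dvd_sum fun x hx => ?_)
    obtain ⟨U, hU, rfl⟩ := Multiset.mem_map.1 hx
    exact hc U hU
  refine ⟨U, (hF U hUF).mono fun g hg => ?_, ?_, hU⟩
  · rcases (hF U hUF).1.1 g hg with rfl | hg
    · exact hh
    · exact (hE hg).1
  · rw [← Set.ncard_coe_finset]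
    calc (U.toFinset : Set G).ncard ≤ (insert h E).ncard :=
          Set.ncard_le_ncard (fun g hg => (hF U hUF).1.1 g (by simpa using hg)) (Set.toFinite _)
      _ ≤ grank G + 1 := (Set.ncard_insert_le _ _).trans (by omega)

/-- If the multiplicities of `h` in the members of `𝒰` have no common prime divisor, they generate
`ℤ/o` as a monoid. -/
theorem exists_multiset_count_sum_eq {α : Type*} [DecidableEq α]
    {𝒰 : Set (Multiset α)} {h : α}
    (h𝒰 : ∀ p : ℕ, p.Prime → ∃ U ∈ 𝒰, ¬ p ∣ U.count h) (o : ℕ) [NeZero o] (x : ZMod o) :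
    ∃ F : Multiset (Multiset α), (∀ U ∈ F, U ∈ 𝒰) ∧ (F.sum.count h : ZMod o) = x := by
  let C : AddSubgroup ℤ := AddSubgroup.closure ((fun U => (U.count h : ℤ)) '' 𝒰)
  have hC : (1 : ℤ) ∈ C := by
    obtain ⟨a, ha⟩ := Int.subgroup_cyclic C
    by_cases h1 : a.natAbs = 1
    · rw [ha, AddSubgroup.mem_closure_singleton]
      exact ⟨a, by rw [smul_eq_mul, ← Int.natAbs_mul_self, h1]; rfl⟩
    · obtain ⟨p, hp, hpa⟩ := Nat.exists_prime_and_dvd h1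
      obtain ⟨U, hU, hpU⟩ := h𝒰 p hp
      have hmem : (U.count h : ℤ) ∈ C := AddSubgroup.subset_closure ⟨U, hU, rfl⟩
      rw [ha, AddSubgroup.mem_closure_singleton] at hmem
      obtain ⟨k, hk⟩ := hmem
      refine absurd ?_ hpU
      rw [← Int.natCast_dvd_natCast, ← hk, smul_eq_mul]
      exact (Int.natCast_dvd.2 hpa).mul_left k
  have hx : x ∈ C.map (Int.castAddHom (ZMod o)) := by
    refine ⟨x.val, ?_, by simp⟩
    simpa using C.nsmul_mem hC x.val
  rw [AddMonoidHom.map_closure, ← AddSubgroup.mem_toAddSubmonoid,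
    AddSubgroup.closure_toAddSubmonoid_of_finite] at hx
  induction hx using AddSubmonoid.closure_induction with
  | mem x hx =>
    obtain ⟨_, ⟨U, hU, rfl⟩, rfl⟩ := hx
    exact ⟨{U}, by simpa using hU, by simp⟩
  | zero => exact ⟨0, by simp, by simp⟩
  | add x y _ _ hx hy =>
    obtain ⟨F, hF, rfl⟩ := hx
    obtain ⟨F', hF', rfl⟩ := hy
    exact ⟨F + F', fun U hU => (Multiset.mem_add.1 hU).elim (hF U) (hF' U), by simp⟩

end ZeroSum

theorem stmt_11 {G : Type*} [AddCommGroup G] [Fintype G] (n r : ℕ)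
    (hn : AddMonoid.exponent G = n) (hnpp : ¬ IsPrimePow n) (hr : grank G = r)
    (G₀ : Set G)
    (hnhf : DeltaSet G₀ ≠ ∅) (hminimal : ∀ G₁ : Set G, G₁ ⊂ G₀ → DeltaSet G₁ = ∅)
    (hlcn : IsLCNSet G₀) (hcard : r + 2 ≤ G₀.ncard)
    (hgen : ∀ h ∈ G₀, h ∈ AddSubgroup.closure (G₀ \ {h}))
    (hG₂ : ∃ G₂ : Set G, G₂ ⊆ G₀ ∧
      AddSubgroup.closure G₂ = AddSubgroup.closure G₀ ∧ G₂.ncard + 2 ≤ G₀.ncard) :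
    ((sInf (DeltaSet G₀) : ℕ) : ℚ) ≤ ((n : ℚ) + r - 3) / 2 := by
  let _ : DecidableEq G := Classical.decEq G
  subst hn hr
  have hatom : ∀ A, IsAtomSeq G₀ A → ∀ g ∈ G₀, g ∉ A → crossNum A = 1 := by
    intro A hA g hg hgA
    refine IsAtomSeq.crossNum_eq_one (G₁ := G₀ \ {g}) (hminimal _ ?_)
      (hA.mono fun x hx => ⟨hA.1.1 x hx, fun hxg => hgA (hxg ▸ hx)⟩)
    exact ⟨Set.sdiff_subset, fun hsub => (hsub hg).2 rfl⟩
  have hfull : ∀ Z, IsZeroSumSeq G₀ Z → ¬ HasUnitFactorization G₀ Z → ∀ g ∈ G₀, g ∈ Z := by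
    intro Z hZ hZu g hg
    by_contra hgZ
    obtain ⟨F, hF, rfl⟩ := hZ.exists_factorization
    exact hZu ⟨F, fun W hW => ⟨hF W hW, hatom W (hF W hW) g hg fun hgW =>
      hgZ (Multiset.mem_of_le (Multiset.le_sum_of_mem hW) hgW)⟩, rfl⟩
  obtain ⟨A, hA, hA1⟩ : ∃ A, IsAtomSeq G₀ A ∧ crossNum A ≠ 1 := by
    by_contra! hc
    exact hnhf (deltaSet_eq_empty_of_crossNum_eq_one hc)
  have hAu : ¬ HasUnitFactorization G₀ A := by
    rintro ⟨F, hF, rfl⟩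
    obtain ⟨W, hW⟩ : ∃ W, W ∈ F := Multiset.exists_mem_of_ne_zero (by rintro rfl; exact hA.2.1 rfl)
    have hWF := hA.2.2 W (Multiset.le_sum_of_mem hW) (hF W hW).1.2.1 (hF W hW).1.1.2
    exact hA1 (hWF ▸ (hF W hW).2)
  obtain ⟨h, hh⟩ : G₀.Nonempty := Set.nonempty_of_ncard_ne_zero (by omega)
  let 𝒰 : Set (Multiset G) := {U | IsAtomSeq G₀ U ∧ U.toFinset.card ≤ grank G + 1}
  have : NeZero (addOrderOf h) := ⟨(addOrderOf_pos h).ne'⟩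
  obtain ⟨F, hF, hFc⟩ := exists_multiset_count_sum_eq (𝒰 := 𝒰) (h := h)
    (fun p hp => by
      obtain ⟨U, hU, hUc, hUp⟩ := exists_atom_not_dvd_count hh (hgen h hh) hp
      exact ⟨U, ⟨hU, hUc⟩, hUp⟩) (addOrderOf h) (-(A.count h : ZMod (addOrderOf h)))
  have hzs : IsZeroSumSeq G₀ (A + F.sum) := by
    refine ⟨fun g hg => ?_, ?_⟩
    · rcases Multiset.mem_add.1 hg with hg | hg
      · exact hA.1.1 g hg
      · obtain ⟨U, hU, hgU⟩ : ∃ U ∈ F, g ∈ U := by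
          simpa [Multiset.mem_bind, Multiset.bind] using
            (Multiset.mem_join (S := F)).1 hg
        exact (hF U hU).1.1.1 g hgU
    · rw [Multiset.sum_add, hA.1.2, zero_add, ← Multiset.coe_sumAddMonoidHom, map_multiset_sum]
      refine Multiset.sum_eq_zero fun x hx => ?_
      obtain ⟨U, hU, rfl⟩ := Multiset.mem_map.1 hx
      exact (hF U hU).1.1.2
  have hprod : HasUnitFactorization G₀ (A + F.sum) := by
    obtain ⟨q, hq⟩ : addOrderOf h ∣ (A + F.sum).count h := by
      rw [← ZMod.natCast_eq_zero_iff, Multiset.count_add, Nat.cast_add, hFc, add_neg_cancel]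
    have hsplit := Multiset.filter_add_not (fun x => x = h) (A + F.sum)
    rw [Multiset.filter_eq', hq, mul_comm, ← Multiset.nsmul_singleton, mul_nsmul',
      Multiset.nsmul_singleton] at hsplit
    have hrest : IsZeroSumSeq G₀ ((A + F.sum).filter fun x => ¬ x = h) := by
      refine ⟨fun g hg => hzs.1 g (Multiset.mem_of_mem_filter hg), ?_⟩
      have := congrArg Multiset.sum hsplit
      simpa [hzs.2, Multiset.sum_nsmul] using this
    rw [← hsplit]
    refine (hasUnitFactorization_nsmul ⟨{Multiset.replicate (addOrderOf h) h}, ?_, by simp⟩ q).add ?_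
    · simpa using ⟨isAtomSeq_replicate hh, crossNum_replicate_addOrderOf h⟩
    · by_contra hc
      exact (Multiset.mem_filter.1 (hfull _ hrest hc h hh)).2 rfl
  obtain ⟨U, hU, Z, hZ, hZu, hZU⟩ :=
    exists_hasUnitFactorization_add (fun U hU => hU.1.1) hF hA.1 hAu hprod
  have hU1 : crossNum U = 1 := by
    obtain ⟨g, hg, hgU⟩ : ∃ g ∈ G₀, g ∉ U := by
      by_contra! hc
      have hle : G₀.ncard ≤ (U.toFinset : Set G).ncard :=
        Set.ncard_le_ncard (fun g hg => by simpa using hc g hg) (Set.toFinite _)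
      rw [Set.ncard_coe_finset] at hle
      have := hU.2
      omega
    exact hatom U hU.1 g hg hgU
  have hbound := two_mul_sInf_deltaSet_add_four_le hlcn hfull hU.1 hU1 hZ hZu hZU
  have hlen := card_le_exponent_mul_crossNum U
  rw [hU1, mul_one] at hlen
  have hsupp : (U.toFinset.card : ℚ) ≤ grank G + 1 := by exact_mod_cast hU.2
  have hbound' : 2 * ((sInf (DeltaSet G₀) : ℕ) : ℚ) + 4 ≤ U.card + U.toFinset.card := by
    exact_mod_cast hbound
  linarith
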